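/- Let α ∈ (0,1) and let u : ℝ → ℝ be defined by u(y) = (1 − y²)^{α/2} for |y| ≤ 1 and u(y) = 0 for |y| > 1. Then for every x ∈ (−1,1), the function y ↦ (u(x) − u(y))/|x − y|^{1+α} is Lebesgue integrable on ℝ and c_{1,α} ∫_ℝ (u(x) − u(y))/|x − y|^{1+α} dy = Γ(1+α). -/

import Mathlib

open MeasureTheory Set

/-- The one-dimensional normalization constant
`c_{1,α} = 2^{α−1} α Γ((1+α)/2) / (√π Γ(1 − α/2))` of the fractional Laplacian. -/
noncomputable def fracLapConst (α : ℝ) : ℝ :=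
  2 ^ (α - 1) * α * Real.Gamma ((1 + α) / 2) / (Real.sqrt Real.pi * Real.Gamma (1 - α / 2))

lemma beta_integrableOn {p q : ℝ} (hp : 0 < p) (hq : 0 < q) :
    IntegrableOn (fun t : ℝ => t ^ (p - 1) * (1 - t) ^ (q - 1)) (Ioo 0 1) := by
  have h := Complex.betaIntegral_convergent (u := (p : ℂ)) (v := (q : ℂ)) (by simpa) (by simpa)
  rw [intervalIntegrable_iff_integrableOn_Ioo_of_le zero_le_one] at h
  have h2 := h.re
  refine (integrableOn_congr_fun ?_ measurableSet_Ioo).1 h2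
  intro t ht
  have e : ((t : ℂ) ^ ((p : ℂ) - 1) * (1 - (t : ℂ)) ^ ((q : ℂ) - 1))
      = ((t ^ (p - 1) * (1 - t) ^ (q - 1) : ℝ) : ℂ) := by
    rw [Complex.ofReal_mul, Complex.ofReal_cpow ht.1.le, Complex.ofReal_cpow (by linarith [ht.2])]
    push_cast
    rfl
  simp only [e]
  simp

lemma beta_integral {p q : ℝ} (hp : 0 < p) (hq : 0 < q) :
    ∫ t in Ioo (0:ℝ) 1, t ^ (p - 1) * (1 - t) ^ (q - 1)
      = Real.Gamma p * Real.Gamma q / Real.Gamma (p + q) := by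
  have h := ProbabilityTheory.beta_eq_betaIntegralReal p q hp hq
  rw [ProbabilityTheory.beta] at h
  rw [h, Complex.betaIntegral, intervalIntegral.integral_of_le zero_le_one,
    integral_Ioc_eq_integral_Ioo]
  have : ∫ t in Ioo (0:ℝ) 1, ((t : ℂ) ^ ((p : ℂ) - 1) * (1 - (t : ℂ)) ^ ((q : ℂ) - 1))
      = ∫ t in Ioo (0:ℝ) 1, ((t ^ (p - 1) * (1 - t) ^ (q - 1) : ℝ) : ℂ) := by
    refine setIntegral_congr_fun measurableSet_Ioo ?_
    intro t ht
    simp only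
    rw [Complex.ofReal_mul, Complex.ofReal_cpow ht.1.le, Complex.ofReal_cpow (by linarith [ht.2])]
    push_cast
    rfl
  rw [this, integral_complex_ofReal, Complex.ofReal_re]

/-- kernel after the Moebius substitution -/
noncomputable def KK (s x w : ℝ) : ℝ :=
  (x + w) / (1 + x * w) * ((1 - w ^ 2) ^ (s - 1) * w ^ (-(2 * s)))

lemma one_add_mul_pos' {x w : ℝ} (hx : x ∈ Ioo (-1 : ℝ) 1) (hw : w ∈ Ioo (0 : ℝ) 1) :
    0 < 1 + x * w := by
  nlinarith [hx.1, hx.2, hw.1, hw.2]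

lemma KK_integrableOn {s x : ℝ} (hs : 0 < s) (hs2 : s < 1 / 2) (hx : x ∈ Ioo (-1 : ℝ) 1) :
    IntegrableOn (KK s x) (Ioo 0 1) := by
  have h := beta_integrableOn (p := 1 - 2 * s) (q := s) (by linarith) hs
  refine Integrable.mono' h ?_ ?_
  · apply Measurable.aestronglyMeasurable
    unfold KK
    fun_prop
  · refine (ae_restrict_iff' measurableSet_Ioo).2 (Filter.Eventually.of_forall ?_)
    intro w hw
    have h1 := one_add_mul_pos' hx hw
    have hw0 := hw.1
    have hw1 := hw.2
    have hx0 := hx.1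
    have hx1 := hx.2
    have a1 : |(x + w) / (1 + x * w)| ≤ 1 := by
      rw [abs_div, abs_of_pos h1, div_le_one h1, abs_le]
      constructor <;> nlinarith
    have b0 : 0 < 1 - w ^ 2 := by nlinarith
    have a2 : (1 - w ^ 2) ^ (s - 1) ≤ (1 - w) ^ (s - 1) :=
      Real.rpow_le_rpow_of_nonpos (by linarith) (by nlinarith) (by linarith)
    have a3 : 0 ≤ (1 - w ^ 2) ^ (s - 1) := Real.rpow_nonneg b0.le _
    have a4 : 0 ≤ w ^ (-(2 * s)) := Real.rpow_nonneg hw0.le _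
    rw [KK, Real.norm_eq_abs, abs_mul, abs_of_nonneg (mul_nonneg a3 a4),
      show 1 - 2 * s - 1 = -(2 * s) by ring]
    calc _ ≤ 1 * ((1 - w ^ 2) ^ (s - 1) * w ^ (-(2 * s))) := by gcongr
      _ ≤ _ := by rw [one_mul, mul_comm]; gcongr

lemma KK_sum {s x : ℝ} (hs : 0 < s) (hs2 : s < 1 / 2) (hx : x ∈ Ioo (-1 : ℝ) 1) :
    (1 - x ^ 2) ^ (-s) * (∫ w in Ioo (0:ℝ) 1, KK s x w)
      + (1 - x ^ 2) ^ (-s) * (∫ w in Ioo (0:ℝ) 1, KK s (-x) w)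
      = Real.Gamma s * Real.Gamma (1 - s) := by
  have hx' : -x ∈ Ioo (-1 : ℝ) 1 := ⟨by linarith [hx.2], by linarith [hx.1]⟩
  have a0 : 0 < 1 - x ^ 2 := by nlinarith [hx.1, hx.2]
  have hb := beta_integral (p := 1 - s) (q := s) (by linarith) hs
  rw [show (1 - s) + s = 1 by ring, Real.Gamma_one, div_one, mul_comm (Real.Gamma _)] at hb
  rw [← mul_add, ← integral_add (KK_integrableOn hs hs2 hx) (KK_integrableOn hs hs2 hx'),
    ← integral_const_mul, ← hb]
  have hd : ∀ w ∈ Ioo (0 : ℝ) 1, 0 < 1 - x ^ 2 * w ^ 2 := by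
    intro w hw
    have := mul_pos (one_add_mul_pos' hx hw) (one_add_mul_pos' hx' hw)
    nlinarith
  set T : ℝ → ℝ := fun w => (1 - x ^ 2) * w ^ 2 / (1 - x ^ 2 * w ^ 2) with hT
  have hder : ∀ w ∈ Ioo (0 : ℝ) 1, HasDerivWithinAt T
      ((1 - x ^ 2) * (2 * w) / (1 - x ^ 2 * w ^ 2) ^ 2) (Ioo 0 1) w := by
    intro w hw
    have h1 : HasDerivAt (fun w : ℝ => (1 - x ^ 2) * w ^ 2) ((1 - x ^ 2) * (2 * w)) w := by
      simpa using (hasDerivAt_pow 2 w).const_mul (1 - x ^ 2)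
    have h2 : HasDerivAt (fun w : ℝ => 1 - x ^ 2 * w ^ 2) (-(x ^ 2 * (2 * w))) w := by
      simpa using ((hasDerivAt_pow 2 w).const_mul (x ^ 2)).const_sub 1
    refine ((h1.div h2 (hd w hw).ne').congr_deriv ?_).hasDerivWithinAt
    congr 1
    ring
  have hinj : InjOn T (Ioo 0 1) := by
    intro w hw v hv h
    simp only [hT] at h
    rw [div_eq_div_iff (hd w hw).ne' (hd v hv).ne'] at h
    have : (1 - x ^ 2) * (w ^ 2 - v ^ 2) = 0 := by linear_combination h
    have h3 : w ^ 2 = v ^ 2 := by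
      rcases mul_eq_zero.1 this with h | h <;> linarith
    exact (pow_left_inj₀ hw.1.le hv.1.le two_ne_zero).1 h3
  have himg : T '' Ioo 0 1 = Ioo 0 1 := by
    ext t
    constructor
    · rintro ⟨w, hw, rfl⟩
      have := hd w hw
      have hw0 := hw.1
      have hw1 := hw.2
      refine ⟨by simp only [hT]; positivity, ?_⟩
      simp only [hT]
      rw [div_lt_one this]
      nlinarith
    · intro ht
      have ht0 := ht.1
      have ht1 := ht.2
      have hq : 0 < 1 - x ^ 2 + x ^ 2 * t := by positivity
      have hr : 0 < t / (1 - x ^ 2 + x ^ 2 * t) := by positivity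
      refine ⟨√(t / (1 - x ^ 2 + x ^ 2 * t)), ⟨Real.sqrt_pos.2 hr, ?_⟩, ?_⟩
      · rw [Real.sqrt_lt' one_pos, one_pow, div_lt_one hq]
        nlinarith
      · simp only [hT]
        rw [Real.sq_sqrt hr.le]
        have : 1 - x ^ 2 * (t / (1 - x ^ 2 + x ^ 2 * t)) = (1 - x ^ 2) / (1 - x ^ 2 + x ^ 2 * t) := by
          field_simp
          ring
        rw [this]
        field_simp
  conv_rhs => rw [← himg]
  rw [integral_image_eq_integral_abs_deriv_smul measurableSet_Ioo hder hinj]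
  refine setIntegral_congr_fun measurableSet_Ioo ?_
  intro w hw
  have hD := hd w hw
  have hw0 := hw.1
  have hw1 := hw.2
  have b0 : 0 < 1 - w ^ 2 := by nlinarith
  have h1 := one_add_mul_pos' hx hw
  have h2 := one_add_mul_pos' hx' hw
  have e1 : 1 - T w = (1 - w ^ 2) / (1 - x ^ 2 * w ^ 2) := by
    simp only [hT]; field_simp; ring
  have hsum : KK s x w + KK s (-x) w
      = 2 * w * (1 - x ^ 2) / (1 - x ^ 2 * w ^ 2) * ((1 - w ^ 2) ^ (s - 1) * w ^ (-(2 * s))) := by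
    rw [KK, KK, ← add_mul]
    congr 1
    rw [div_add_div _ _ h1.ne' h2.ne', div_eq_div_iff (mul_pos h1 h2).ne' hD.ne']
    ring
  have hw2 : (w ^ 2) ^ (1 - s - 1) = w ^ (-(2 * s)) := by
    rw [← Real.rpow_natCast w 2, ← Real.rpow_mul hw0.le]
    congr 1
    push_cast
    ring
  simp only [smul_eq_mul]
  rw [hsum, e1, abs_of_nonneg (by positivity)]
  simp only [hT]
  rw [Real.div_rpow (by positivity) hD.le, Real.div_rpow b0.le hD.le,
    Real.mul_rpow a0.le (by positivity), hw2,
    show 1 - s - 1 = -s by ring, Real.rpow_neg hD.le, Real.rpow_sub_one hD.ne']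
  have : 0 < (1 - x ^ 2 * w ^ 2) ^ s := Real.rpow_pos_of_pos hD _
  field_simp

lemma jj_subst {s x : ℝ} (hs : 0 < s) (hs2 : s < 1 / 2) (hx : x ∈ Ioo (-1 : ℝ) 1) :
    IntegrableOn (fun y : ℝ => y * (1 - y ^ 2) ^ (s - 1) * (y - x) ^ (-(2 * s))) (Ioo x 1) ∧
    ∫ y in Ioo x 1, y * (1 - y ^ 2) ^ (s - 1) * (y - x) ^ (-(2 * s))
      = (1 - x ^ 2) ^ (-s) * ∫ w in Ioo (0:ℝ) 1, KK s x w := by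
  have hx0 := hx.1
  have hx1 := hx.2
  have a0 : 0 < 1 - x ^ 2 := by nlinarith [hx.1, hx.2]
  set M : ℝ → ℝ := fun w => (x + w) / (1 + x * w) with hM
  have hder : ∀ w ∈ Ioo (0 : ℝ) 1, HasDerivWithinAt M
      ((1 - x ^ 2) / (1 + x * w) ^ 2) (Ioo 0 1) w := by
    intro w hw
    have h1 : HasDerivAt (fun w : ℝ => x + w) 1 w := by
      simpa using (hasDerivAt_id w).const_add x
    have h2 : HasDerivAt (fun w : ℝ => 1 + x * w) x w := by
      simpa using ((hasDerivAt_id w).const_mul x).const_add 1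
    refine ((h1.div h2 (one_add_mul_pos' hx hw).ne').congr_deriv ?_).hasDerivWithinAt
    congr 1
    ring
  have hinj : InjOn M (Ioo 0 1) := by
    intro w hw v hv h
    simp only [hM] at h
    rw [div_eq_div_iff (one_add_mul_pos' hx hw).ne' (one_add_mul_pos' hx hv).ne'] at h
    have : (1 - x ^ 2) * (w - v) = 0 := by linear_combination h
    rcases mul_eq_zero.1 this with h | h <;> linarith
  have himg : M '' Ioo 0 1 = Ioo x 1 := by
    ext y
    constructor
    · rintro ⟨w, hw, rfl⟩
      have h1 := one_add_mul_pos' hx hw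
      have hw0 := hw.1
      have hw1 := hw.2
      simp only [hM]
      refine ⟨?_, ?_⟩
      · rw [lt_div_iff₀ h1]
        nlinarith
      · rw [div_lt_one h1]
        nlinarith
    · intro hy
      have hy0 := hy.1
      have hy1 := hy.2
      have hq : 0 < 1 - x * y := by nlinarith
      refine ⟨(y - x) / (1 - x * y), ⟨div_pos (by linarith) hq, ?_⟩, ?_⟩
      · rw [div_lt_one hq]
        nlinarith
      · simp only [hM]
        have e1 : x + (y - x) / (1 - x * y) = y * (1 - x ^ 2) / (1 - x * y) := by
          field_simp
          ring
        have e2 : 1 + x * ((y - x) / (1 - x * y)) = (1 - x ^ 2) / (1 - x * y) := by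
          field_simp
          ring
        rw [e1, e2, div_div_div_cancel_right₀ hq.ne', mul_div_assoc, div_self a0.ne', mul_one]
  have key : ∀ w ∈ Ioo (0 : ℝ) 1, |(1 - x ^ 2) / (1 + x * w) ^ 2| •
      (M w * (1 - M w ^ 2) ^ (s - 1) * (M w - x) ^ (-(2 * s)))
      = (1 - x ^ 2) ^ (-s) * KK s x w := by
    intro w hw
    have h1 := one_add_mul_pos' hx hw
    have hw0 := hw.1
    have hw1 := hw.2
    have b0 : 0 < 1 - w ^ 2 := by nlinarith
    have e1 : 1 - M w ^ 2 = (1 - x ^ 2) * (1 - w ^ 2) / (1 + x * w) ^ 2 := by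
      simp only [hM]; field_simp; ring
    have e2 : M w - x = (1 - x ^ 2) * w / (1 + x * w) := by
      simp only [hM]; field_simp; ring
    rw [e1, e2, abs_of_nonneg (by positivity), smul_eq_mul, KK,
      Real.div_rpow (by positivity) (by positivity), Real.div_rpow (by positivity) h1.le,
      Real.mul_rpow a0.le b0.le, Real.mul_rpow a0.le hw0.le]
    have p1 : ((1 + x * w) ^ 2) ^ (s - 1) * (1 + x * w) ^ (-(2 * s)) * (1 + x * w) ^ 2 = 1 := by
      rw [← Real.rpow_natCast (1 + x * w) 2, ← Real.rpow_mul h1.le, ← Real.rpow_add h1,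
        ← Real.rpow_add h1]
      have : ((2 : ℕ) : ℝ) * (s - 1) + -(2 * s) + ((2 : ℕ) : ℝ) = 0 := by
        push_cast
        ring
      rw [this, Real.rpow_zero]
    have p2 : (1 - x ^ 2) * (1 - x ^ 2) ^ (s - 1) * (1 - x ^ 2) ^ (-(2 * s))
        = (1 - x ^ 2) ^ (-s) := by
      nth_rewrite 1 [← Real.rpow_one (1 - x ^ 2)]
      rw [← Real.rpow_add a0, ← Real.rpow_add a0]
      congr 1
      ring
    rw [← p2]
    have q1 : 0 < ((1 + x * w) ^ 2) ^ (s - 1) := by positivity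
    have q2 : 0 < (1 + x * w) ^ (-(2 * s)) := by positivity
    generalize ((1 + x * w) ^ 2) ^ (s - 1) = A at *
    generalize (1 + x * w) ^ (-(2 * s)) = B at *
    generalize (1 - x ^ 2) ^ (s - 1) = C
    generalize (1 - x ^ 2) ^ (-(2 * s)) = D
    generalize (1 - w ^ 2) ^ (s - 1) = E
    generalize w ^ (-(2 * s)) = F
    calc _ = (1 - x ^ 2) * C * D * (M w * (E * F)) / (A * B * (1 + x * w) ^ 2) := by
            field_simp
      _ = _ := by rw [p1, div_one]
  constructor
  · rw [← himg, integrableOn_image_iff_integrableOn_abs_deriv_smul measurableSet_Ioo hder hinj]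
    refine (integrableOn_congr_fun ?_ measurableSet_Ioo).2
      ((KK_integrableOn hs hs2 hx).const_mul ((1 - x ^ 2) ^ (-s)))
    exact key
  · rw [← himg, integral_image_eq_integral_abs_deriv_smul measurableSet_Ioo hder hinj,
      ← integral_const_mul]
    exact setIntegral_congr_fun measurableSet_Ioo key

lemma rpow_sub_bound {a b s : ℝ} (ha : 0 < a) (hb : 0 ≤ b) (hs : 0 < s) (hs1 : s < 1) :
    |a ^ s - b ^ s| ≤ a ^ (s - 1) * |a - b| := by
  have key : ∀ r : ℝ, 0 ≤ r → |1 - r ^ s| ≤ |1 - r| := by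
    intro r hr
    rcases le_total r 1 with h | h
    · have h1 : r ^ s ≤ 1 := Real.rpow_le_one hr h hs.le
      rw [abs_of_nonneg (by linarith), abs_of_nonneg (by linarith)]
      rcases hr.eq_or_lt with h0 | h0
      · rw [← h0, Real.zero_rpow hs.ne']
      · have : r ^ (1:ℝ) ≤ r ^ s := Real.rpow_le_rpow_of_exponent_ge h0 h hs1.le
        rw [Real.rpow_one] at this
        linarith
    · have h1 : 1 ≤ r ^ s := Real.one_le_rpow h hs.le
      have : r ^ s ≤ r ^ (1:ℝ) := Real.rpow_le_rpow_of_exponent_le h hs1.le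
      rw [Real.rpow_one] at this
      rw [abs_of_nonpos (by linarith), abs_of_nonpos (by linarith)]
      linarith
  have h := key (b / a) (by positivity)
  have e1 : a ^ s - b ^ s = a ^ s * (1 - (b / a) ^ s) := by
    rw [Real.div_rpow hb ha.le]
    have := Real.rpow_pos_of_pos ha s
    field_simp
  have e2 : a ^ (s - 1) * |a - b| = a ^ s * |1 - b / a| := by
    rw [show a - b = a * (1 - b / a) by field_simp, abs_mul, abs_of_pos ha,
      Real.rpow_sub_one ha.ne']
    field_simp
  rw [e1, e2, abs_mul, abs_of_pos (Real.rpow_pos_of_pos ha s)]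
  gcongr

lemma ff_bound {s x y : ℝ} (hs : 0 < s) (hs2 : s < 1 / 2) (hx : x ∈ Ioo (-1 : ℝ) 1)
    (hy : y ∈ Ioo x 1) :
    |(1 - x ^ 2) ^ s - (1 - y ^ 2) ^ s| ≤ 2 * (1 - x ^ 2) ^ (s - 1) * (y - x) := by
  have hx0 := hx.1
  have hx1 := hx.2
  have hy0 := hy.1
  have hy1 := hy.2
  have a0 : 0 < 1 - x ^ 2 := by nlinarith
  have b0 : 0 < 1 - y ^ 2 := by nlinarith
  refine (rpow_sub_bound a0 b0.le hs (by linarith)).trans ?_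
  have : |1 - x ^ 2 - (1 - y ^ 2)| ≤ 2 * (y - x) := by
    rw [show 1 - x ^ 2 - (1 - y ^ 2) = (y - x) * (y + x) by ring, abs_mul,
      abs_of_pos (by linarith : 0 < y - x), mul_comm]
    refine mul_le_mul_of_nonneg_right ?_ (by linarith)
    rw [abs_le]; constructor <;> linarith
  calc _ ≤ (1 - x ^ 2) ^ (s - 1) * (2 * (y - x)) := by gcongr
    _ = _ := by ring

lemma ff_integrableOn {s x : ℝ} (hs : 0 < s) (hs2 : s < 1 / 2) (hx : x ∈ Ioo (-1 : ℝ) 1) :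
    IntegrableOn (fun y : ℝ => ((1 - x ^ 2) ^ s - (1 - y ^ 2) ^ s) * (y - x) ^ (-(1 + 2 * s)))
      (Ioo x 1) := by
  have h0 : IntegrableOn (fun y : ℝ => (y - x) ^ (-(2 * s))) (Ioo x 1) := by
    have h := (intervalIntegral.intervalIntegrable_rpow' (a := x - x) (b := 1 - x)
      (r := -(2 * s)) (by linarith)).comp_sub_right x
    rw [sub_add_cancel, sub_add_cancel,
      intervalIntegrable_iff_integrableOn_Ioo_of_le hx.2.le] at h
    exact h
  refine Integrable.mono' (h0.const_mul (2 * (1 - x ^ 2) ^ (s - 1))) ?_ ?_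
  · apply Measurable.aestronglyMeasurable
    fun_prop
  · refine (ae_restrict_iff' measurableSet_Ioo).2 (Filter.Eventually.of_forall ?_)
    intro y hy
    have hp : 0 < y - x := by linarith [hy.1]
    have hb := ff_bound hs hs2 hx hy
    rw [Real.norm_eq_abs, abs_mul, abs_of_pos (Real.rpow_pos_of_pos hp _)]
    calc _ ≤ 2 * (1 - x ^ 2) ^ (s - 1) * (y - x) * (y - x) ^ (-(1 + 2 * s)) := by gcongr
      _ = _ := by
        rw [mul_assoc _ (y - x)]
        congr 1
        nth_rewrite 1 [← Real.rpow_one (y - x)]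
        rw [← Real.rpow_add hp]
        congr 1
        ring

lemma ff_integral {s x : ℝ} (hs : 0 < s) (hs2 : s < 1 / 2) (hx : x ∈ Ioo (-1 : ℝ) 1) :
    ∫ y in Ioo x 1, ((1 - x ^ 2) ^ s - (1 - y ^ 2) ^ s) * (y - x) ^ (-(1 + 2 * s))
      = (1 - x ^ 2) ^ (-s) * (∫ w in Ioo (0:ℝ) 1, KK s x w)
        - (1 - x ^ 2) ^ s * (1 - x) ^ (-(2 * s)) / (2 * s) := by
  have hx0 := hx.1
  have hx1 := hx.2
  have a0 : 0 < 1 - x ^ 2 := by nlinarith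
  obtain ⟨hj, hjv⟩ := jj_subst hs hs2 hx
  have hf := ff_integrableOn hs hs2 hx
  have hint := hf.sub hj
  have hG := intervalIntegral.integral_eq_sub_of_hasDerivAt_of_tendsto
    (f := fun y : ℝ => -(1 / (2 * s)) * (((1 - x ^ 2) ^ s - (1 - y ^ 2) ^ s) *
        (y - x) ^ (-(2 * s))))
    (f' := fun y : ℝ => ((1 - x ^ 2) ^ s - (1 - y ^ 2) ^ s) * (y - x) ^ (-(1 + 2 * s))
      - y * (1 - y ^ 2) ^ (s - 1) * (y - x) ^ (-(2 * s)))
    (fa := 0) (fb := -(1 / (2 * s)) * (((1 - x ^ 2) ^ s - (1 - 1 ^ 2) ^ s) *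
        (1 - x) ^ (-(2 * s)))) hx1 ?_ ?_ ?_ ?_
  · rw [intervalIntegral.integral_of_le hx1.le, integral_Ioc_eq_integral_Ioo,
      integral_sub hf hj, hjv] at hG
    rw [show (1 - 1 ^ 2 : ℝ) = 0 by norm_num, Real.zero_rpow hs.ne'] at hG
    linear_combination hG
  · intro y hy
    have hp : 0 < y - x := by linarith [hy.1]
    have b0 : 0 < 1 - y ^ 2 := by nlinarith [hy.1, hy.2]
    have h1 : HasDerivAt (fun y : ℝ => 1 - y ^ 2) (-(2 * y)) y := by
      simpa using (hasDerivAt_pow 2 y).const_sub 1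
    have h2 : HasDerivAt (fun y : ℝ => y - x) 1 y := by
      simpa using (hasDerivAt_id y).sub_const x
    have h3 := (h1.rpow_const (p := s) (Or.inl b0.ne')).const_sub ((1 - x ^ 2) ^ s)
    have h4 := h2.rpow_const (p := -(2 * s)) (Or.inl hp.ne')
    refine ((h3.mul h4).const_mul (-(1 / (2 * s)))).congr_deriv ?_
    rw [show -(2 * s) - 1 = -(1 + 2 * s) by ring]
    field_simp
    ring
  · rw [intervalIntegrable_iff_integrableOn_Ioo_of_le hx1.le]
    exact hint
  · have hlim : Filter.Tendsto (fun y : ℝ => (1 / (2 * s)) * (2 * (1 - x ^ 2) ^ (s - 1) *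
        (y - x) ^ (1 - 2 * s))) (nhdsWithin x (Ioi x)) (nhds 0) := by
      have hc : ContinuousAt (fun y : ℝ => (1 / (2 * s)) * (2 * (1 - x ^ 2) ^ (s - 1) *
        (y - x) ^ (1 - 2 * s))) x := by
        have : ContinuousAt (fun y : ℝ => (y - x) ^ (1 - 2 * s)) x :=
          ContinuousAt.rpow_const (by fun_prop) (Or.inr (by linarith))
        fun_prop
      have := hc.tendsto
      simp only [sub_self] at this
      rw [Real.zero_rpow (by linarith), mul_zero, mul_zero] at this
      exact this.mono_left nhdsWithin_le_nhds
    refine squeeze_zero_norm' ?_ hlim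
    filter_upwards [Ioo_mem_nhdsGT hx1] with y hy
    have hp : 0 < y - x := by linarith [hy.1]
    have hb := ff_bound hs hs2 hx hy
    rw [Real.norm_eq_abs, abs_mul, abs_mul, abs_neg, abs_of_pos (by positivity : 0 < 1 / (2 * s)),
      abs_of_pos (Real.rpow_pos_of_pos hp _)]
    refine mul_le_mul_of_nonneg_left ?_ (by positivity)
    calc _ ≤ 2 * (1 - x ^ 2) ^ (s - 1) * (y - x) * (y - x) ^ (-(2 * s)) := by gcongr
      _ = _ := by
        rw [mul_assoc _ (y - x)]
        congr 1
        nth_rewrite 1 [← Real.rpow_one (y - x)]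
        rw [← Real.rpow_add hp]
        congr 1
  · have hc : ContinuousAt (fun y : ℝ => -(1 / (2 * s)) * (((1 - x ^ 2) ^ s - (1 - y ^ 2) ^ s) *
        (y - x) ^ (-(2 * s)))) 1 := by
      have c1 : ContinuousAt (fun y : ℝ => (1 - y ^ 2) ^ s) 1 :=
        ContinuousAt.rpow_const (by fun_prop) (Or.inr hs.le)
      have c2 : ContinuousAt (fun y : ℝ => (y - x) ^ (-(2 * s))) 1 :=
        ContinuousAt.rpow_const (by fun_prop) (Or.inl (by linarith))
      fun_prop
    exact hc.tendsto.mono_left nhdsWithin_le_nhds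

lemma tail_integral {s x c : ℝ} (hs : 0 < s) (hx : x < 1) :
    IntegrableOn (fun y : ℝ => c * (y - x) ^ (-(1 + 2 * s))) (Ici 1) ∧
    ∫ y in Ici (1:ℝ), c * (y - x) ^ (-(1 + 2 * s)) = c * (1 - x) ^ (-(2 * s)) / (2 * s) := by
  have h1 : IntegrableOn (fun y : ℝ => (y - x) ^ (-(1 + 2 * s))) (Ioi 1) := by
    simpa [sub_eq_add_neg] using
      integrableOn_add_rpow_Ioi_of_lt (a := -(1 + 2 * s)) (c := 1) (m := -x)
        (by linarith) (by linarith)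
  constructor
  · rw [integrableOn_Ici_iff_integrableOn_Ioi]
    exact h1.const_mul c
  · rw [integral_Ici_eq_integral_Ioi, integral_const_mul]
    have h2 := integral_Ioi_rpow_of_lt (a := -(1 + 2 * s)) (by linarith) (c := 1 - x) (by linarith)
    have h3 : ∫ y in Ioi (1:ℝ), (y - x) ^ (-(1 + 2 * s)) = ∫ t in Ioi (1 - x), t ^ (-(1 + 2 * s)) := by
      have hmp := measurePreserving_sub_right (volume : Measure ℝ) x
      have := hmp.setIntegral_preimage_emb (measurableEmbedding_subRight x)
        (fun t : ℝ => t ^ (-(1 + 2 * s))) (Ioi (1 - x))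
      simpa using this
    rw [h3, h2, show -(1 + 2 * s) + 1 = -(2 * s) by ring]
    field_simp

lemma half_line {s x : ℝ} (hs : 0 < s) (hs2 : s < 1 / 2) (hx : x ∈ Ioo (-1 : ℝ) 1) (u : ℝ → ℝ)
    (hu : ∀ y : ℝ, u y = if |y| ≤ 1 then (1 - y ^ 2) ^ s else 0) :
    IntegrableOn (fun y : ℝ => (u x - u y) / |x - y| ^ (1 + 2 * s)) (Ioi x) ∧
    ∫ y in Ioi x, (u x - u y) / |x - y| ^ (1 + 2 * s)
      = (1 - x ^ 2) ^ (-s) * (∫ w in Ioo (0:ℝ) 1, KK s x w) := by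
  have hx0 := hx.1
  have hx1 := hx.2
  have hux : u x = (1 - x ^ 2) ^ s := by
    rw [hu, if_pos (abs_le.2 ⟨hx0.le, hx1.le⟩)]
  have hker : ∀ y, x < y → ∀ c : ℝ, c / |x - y| ^ (1 + 2 * s) = c * (y - x) ^ (-(1 + 2 * s)) := by
    intro y hy c
    rw [abs_sub_comm, abs_of_pos (by linarith), Real.rpow_neg (by linarith), div_eq_mul_inv]
  have k1 : ∀ y ∈ Ioo x 1, (u x - u y) / |x - y| ^ (1 + 2 * s)
      = ((1 - x ^ 2) ^ s - (1 - y ^ 2) ^ s) * (y - x) ^ (-(1 + 2 * s)) := by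
    intro y hy
    rw [hker y hy.1, hux, hu y, if_pos (abs_le.2 ⟨by linarith [hy.1], hy.2.le⟩)]
  have k2 : ∀ y ∈ Ici (1:ℝ), (u x - u y) / |x - y| ^ (1 + 2 * s)
      = (1 - x ^ 2) ^ s * (y - x) ^ (-(1 + 2 * s)) := by
    intro y hy
    have hy' : (1:ℝ) ≤ y := hy
    have h0 : u y = 0 := by
      rw [hu y]
      split_ifs with h
      · have : y = 1 := le_antisymm (abs_le.1 h).2 hy'
        rw [this, show (1 - 1 ^ 2 : ℝ) = 0 by norm_num, Real.zero_rpow hs.ne']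
      · rfl
    rw [hker y (by linarith), hux, h0, sub_zero]
  obtain ⟨t1, t2⟩ := tail_integral (s := s) (x := x) (c := (1 - x ^ 2) ^ s) hs hx1
  have i1 := (integrableOn_congr_fun k1 measurableSet_Ioo).2 (ff_integrableOn hs hs2 hx)
  have i2 := (integrableOn_congr_fun k2 measurableSet_Ici).2 t1
  have hun : Ioi x = Ioo x 1 ∪ Ici 1 := (Ioo_union_Ici_eq_Ioi hx1).symm
  rw [hun]
  refine ⟨i1.union i2, ?_⟩
  rw [setIntegral_union ?_ measurableSet_Ici i1 i2, setIntegral_congr_fun measurableSet_Ioo k1,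
    setIntegral_congr_fun measurableSet_Ici k2, t2, ff_integral hs hs2 hx]
  · ring
  · rw [Set.disjoint_left]
    intro y h1 h2
    exact absurd h1.2 (not_lt.2 h2)

/-- For `α ∈ (0,1)`, the function `u(y) = (1 − y²)_+^{α/2}` solves the benchmark fractional
Poisson problem: for every `x ∈ (−1,1)` the integrand of `(−Δ)^{α/2}u(x)` is integrable
and `c_{1,α} ∫_ℝ (u(x) − u(y))/|x − y|^{1+α} dy = Γ(1+α)`. -/
theorem stmt16 (α : ℝ) (hα : α ∈ Set.Ioo (0:ℝ) 1) (u : ℝ → ℝ)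
    (hu : ∀ y : ℝ, u y = if |y| ≤ 1 then (1 - y ^ 2) ^ (α / 2) else 0) :
    ∀ x ∈ Set.Ioo (-1 : ℝ) 1,
      Integrable (fun y : ℝ => (u x - u y) / |x - y| ^ (1 + α)) volume ∧
      fracLapConst α * (∫ y : ℝ, (u x - u y) / |x - y| ^ (1 + α)) = Real.Gamma (1 + α) := by
  intro x hx
  obtain ⟨s, rfl⟩ : ∃ s, α = 2 * s := ⟨α / 2, by ring⟩
  rw [show 2 * s / 2 = s by ring] at hu
  have hs : 0 < s := by linarith [hα.1]
  have hs2 : s < 1 / 2 := by linarith [hα.2]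
  have hx' : -x ∈ Ioo (-1 : ℝ) 1 := ⟨by linarith [hx.2], by linarith [hx.1]⟩
  obtain ⟨r1, r2⟩ := half_line hs hs2 hx u hu
  obtain ⟨l1, l2⟩ := half_line hs hs2 hx' u hu
  have ueven : ∀ y, u (-y) = u y := by
    intro y
    rw [hu, hu, abs_neg, neg_sq]
  have hsym : (fun y : ℝ => (u (-x) - u y) / |-x - y| ^ (1 + 2 * s))
      = fun y : ℝ => (fun z : ℝ => (u x - u z) / |x - z| ^ (1 + 2 * s)) (-y) := by
    funext y
    simp only [ueven]
    rw [show -x - y = -(x - -y) by ring, abs_neg]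
  rw [hsym] at l1 l2
  rw [integral_comp_neg_Ioi (-x) (fun z : ℝ => (u x - u z) / |x - z| ^ (1 + 2 * s)),
    neg_neg, neg_sq] at l2
  have l1' : IntegrableOn (fun y : ℝ => (u x - u y) / |x - y| ^ (1 + 2 * s)) (Iic x) := by
    have := l1.comp_neg
    rw [integrableOn_Iic_iff_integrableOn_Iio]
    simpa using this
  have hI : Integrable (fun y : ℝ => (u x - u y) / |x - y| ^ (1 + 2 * s)) := by
    rw [← integrableOn_univ, ← Iic_union_Ioi (a := x)]
    exact l1'.union r1
  refine ⟨hI, ?_⟩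
  rw [← intervalIntegral.integral_Iic_add_Ioi l1' r1, r2, l2, add_comm, KK_sum hs hs2 hx,
    fracLapConst]
  have d := Real.Gamma_mul_Gamma_add_half (s + 1 / 2)
  rw [show s + 1 / 2 + 1 / 2 = s + 1 by ring, Real.Gamma_add_one hs.ne',
    show 2 * (s + 1 / 2) = 1 + 2 * s by ring, show 1 - (1 + 2 * s) = -(2 * s) by ring] at d
  rw [show (1 + 2 * s) / 2 = s + 1 / 2 by ring, show 2 * s / 2 = s by ring,
    Real.rpow_sub_one two_ne_zero]
  have g1 : 0 < Real.Gamma (1 - s) := Real.Gamma_pos_of_pos (by linarith)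
  have g2 : 0 < √Real.pi := Real.sqrt_pos.2 Real.pi_pos
  rw [Real.rpow_neg zero_le_two] at d
  have g3 : (0:ℝ) < 2 ^ (2 * s) := by positivity
  field_simp at d ⊢
  linear_combination d
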